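/- arXiv:2410.17379 — 5 statements merged into one kernel-verified Lean document; each statement's English description precedes it below -/
import Mathlib

section
/- Let Γ be a finite abelian group of order m and let G be a tm×tm complex matrix viewed as a t×t array of blocks G_{i,j} ∈ ℂ^{Γ×Γ}. Then G is the Gram matrix of some t-generator Γ-harmonic collection of vectors (in some finite-dimensional complex inner product space) if and only if G is positive semidefinite and every block G_{i,j} is Γ-stable, i.e., (G_{i,j})_{k+g,k+h} = (G_{i,j})_{g,h} for all g, h, k ∈ Γ. -/
noncomputable section

open Matrix
open scoped ComplexOrder

/-- `G` is the Gram matrix of a `t`-generator `Γ`-harmonic collection of vectors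
`{ρ(g) ψ_i}` in some finite-dimensional complex inner product space, where
`ρ` is a unitary representation of `Γ` and `ψ_1, …, ψ_t` are the generators.
Inner products are conjugate-linear in the first argument. -/
def IsHarmonicGram {Γ : Type*} [AddCommGroup Γ] [Fintype Γ] (t : ℕ)
    (G : Matrix (Γ × Fin t) (Γ × Fin t) ℂ) : Prop :=
  ∃ (D : ℕ) (ρ : Γ → Matrix (Fin D) (Fin D) ℂ) (ψ : Fin t → (Fin D → ℂ)),
    (∀ g, ρ g ∈ Matrix.unitaryGroup (Fin D) ℂ) ∧
    ρ 0 = 1 ∧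
    (∀ g h, ρ (g + h) = ρ g * ρ h) ∧
    ∀ (g h : Γ) (i j : Fin t),
      G (g, i) (h, j) = star (ρ g *ᵥ ψ i) ⬝ᵥ (ρ h *ᵥ ψ j)

open scoped MatrixOrder in
/-- If a positive semidefinite matrix is invariant under a permutation of its index set, then so is
its square root. -/
lemma sqrt_submatrix_of_submatrix_eq {n : Type*} [Fintype n] [DecidableEq n] {G : Matrix n n ℂ}
    (hG : G.PosSemidef) (σ : Equiv.Perm n) (hσ : G.submatrix σ σ = G) :
    (CFC.sqrt G).submatrix σ σ = CFC.sqrt G := by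
  have hS : (CFC.sqrt G).PosSemidef := (CFC.sqrt_nonneg G).posSemidef
  refine (CFC.sqrt_unique ?_ (hS.submatrix σ).nonneg).symm
  rw [submatrix_mul_equiv, CFC.sqrt_mul_sqrt_self G hG.nonneg, hσ]

lemma permMatrix_mem_unitaryGroup {n : Type*} [Fintype n] [DecidableEq n] (σ : Equiv.Perm n) :
    σ.permMatrix ℂ ∈ Matrix.unitaryGroup n ℂ := by
  rw [mem_unitaryGroup_iff, star_eq_conjTranspose, conjTranspose_permMatrix, ← permMatrix_mul,
    inv_mul_cancel, permMatrix_one]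

lemma star_mulVec_dotProduct_mulVec_of_mem_unitaryGroup {n : Type*} [Fintype n] [DecidableEq n]
    {U : Matrix n n ℂ} (hU : U ∈ Matrix.unitaryGroup n ℂ) (v w : n → ℂ) :
    star (U *ᵥ v) ⬝ᵥ (U *ᵥ w) = star v ⬝ᵥ w := by
  rw [star_mulVec, ← dotProduct_mulVec, mulVec_mulVec, ← star_eq_conjTranspose,
    mem_unitaryGroup_iff'.mp hU, one_mulVec]

lemma IsHarmonicGram.posSemidef {Γ : Type*} [AddCommGroup Γ] [Fintype Γ] {t : ℕ}
    {G : Matrix (Γ × Fin t) (Γ × Fin t) ℂ} (hG : IsHarmonicGram t G) : G.PosSemidef := by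
  obtain ⟨D, ρ, ψ, -, -, -, hρ⟩ := hG
  let B : Matrix (Fin D) (Γ × Fin t) ℂ := Matrix.of fun a x => (ρ x.1 *ᵥ ψ x.2) a
  have hB : G = Bᴴ * B := by
    ext ⟨g, i⟩ ⟨h, j⟩
    rw [hρ]
    rfl
  rw [hB]
  exact posSemidef_conjTranspose_mul_self B

lemma IsHarmonicGram.apply_add_left {Γ : Type*} [AddCommGroup Γ] [Fintype Γ] {t : ℕ}
    {G : Matrix (Γ × Fin t) (Γ × Fin t) ℂ} (hG : IsHarmonicGram t G) (i j : Fin t) (g h k : Γ) :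
    G (k + g, i) (k + h, j) = G (g, i) (h, j) := by
  obtain ⟨D, ρ, ψ, hU, -, hadd, hρ⟩ := hG
  rw [hρ, hρ, hadd, hadd, ← mulVec_mulVec, ← mulVec_mulVec,
    star_mulVec_dotProduct_mulVec_of_mem_unitaryGroup (hU k)]

open scoped MatrixOrder in
/-- The columns of the square root of `G` form a harmonic collection under the regular
representation of `Γ` on `Γ × Fin t`. -/
lemma isHarmonicGram_of_posSemidef {Γ : Type*} [AddCommGroup Γ] [Fintype Γ] {t : ℕ}
    {G : Matrix (Γ × Fin t) (Γ × Fin t) ℂ} (hG : G.PosSemidef)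
    (hstable : ∀ (i j : Fin t) (g h k : Γ), G (k + g, i) (k + h, j) = G (g, i) (h, j)) :
    IsHarmonicGram t G := by
  classical
  let S : Matrix (Γ × Fin t) (Γ × Fin t) ℂ := CFC.sqrt G
  have hSS : Sᴴ * S = G := by
    rw [(CFC.sqrt_nonneg G).posSemidef.isHermitian.eq, CFC.sqrt_mul_sqrt_self G hG.nonneg]
  let e := Fintype.equivFin (Γ × Fin t)
  let τ (k : Γ) : Equiv.Perm (Γ × Fin t) := (Equiv.addLeft k).prodCongr (Equiv.refl _)
  have hS (k : Γ) (a b : Γ × Fin t) : S (τ k a) (τ k b) = S a b := by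
    have hτ : G.submatrix (τ k) (τ k) = G := by
      ext a b
      exact hstable _ _ _ _ _
    exact congr_fun₂ (sqrt_submatrix_of_submatrix_eq hG (τ k) hτ) a b
  let ρ (k : Γ) : Matrix (Fin (Fintype.card (Γ × Fin t))) (Fin (Fintype.card (Γ × Fin t))) ℂ :=
    (e.permCongr (τ (-k))).permMatrix ℂ
  let ψ (i : Fin t) (a : Fin (Fintype.card (Γ × Fin t))) : ℂ := S (e.symm a) (0, i)
  have hψ (g : Γ) (i : Fin t) : ρ g *ᵥ ψ i = fun a => S (e.symm a) (g, i) := by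
    ext a
    rw [permMatrix_mulVec, ← hS (-g) (e.symm a) (g, i)]
    simp [ψ, τ]
  refine ⟨_, ρ, ψ, fun g => permMatrix_mem_unitaryGroup _, ?_, fun g h => ?_, fun g h i j => ?_⟩
  · have hτ : e.permCongr (τ (-0)) = 1 := by
      ext a
      simp [τ]
    simp only [ρ, hτ, permMatrix_one]
  · have hτ : e.permCongr (τ (-(g + h))) = e.permCongr (τ (-h)) * e.permCongr (τ (-g)) := by
      ext a
      simp [τ, Prod.map]
    simp only [ρ, hτ, permMatrix_mul]
  · rw [hψ, hψ, ← hSS]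
    exact (e.symm.sum_comp fun a => star (S a (g, i)) * S a (h, j)).symm

theorem harmonic_gram_characterization {Γ : Type*} [AddCommGroup Γ] [Fintype Γ]
    (t : ℕ) (G : Matrix (Γ × Fin t) (Γ × Fin t) ℂ) :
    IsHarmonicGram t G ↔
      (G.PosSemidef ∧
        ∀ (i j : Fin t) (g h k : Γ), G (k + g, i) (k + h, j) = G (g, i) (h, j)) := by
  exact ⟨fun hG => ⟨hG.posSemidef, hG.apply_add_left⟩,
    fun hG => isHarmonicGram_of_posSemidef hG.1 hG.2⟩
end
end

section
/- Fix a polynomial map f: ℝ^m → ℝ^n of total degree d and a point x₀ ∈ ℝ^m. Given δ > 0, let S: ℝ^m → ℝ^n be the linear map (δ-secant approximation of the Jacobian of f at x₀) defined on the standard basis by S e_j = (f(x₀ + δe_j) − f(x₀))/δ. For α > 0 write α̃ = α·max{1, ‖x₀‖_∞ + α}^{d−2}. Suppose there exist ε > 0 and a linear map T: ℝ^n → ℝ^m such that ‖S∘T − id_{ℝⁿ}‖_{∞→∞} + ((1/2)δ̃ + ε̃)·|f|·d(d−1)·‖T‖_{∞→∞} < 1 − (1/ε)·‖T‖_{∞→∞}·‖f(x₀)‖_∞.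 Then there exists x* ∈ ℝ^m with f(x*) = 0 and ‖x* − x₀‖_∞ < ε, and moreover f⁻¹(0) is locally a smooth manifold of dimension m − n near x*. -/
noncomputable section

open Matrix

/-- The `∞→∞` operator norm of a matrix: the maximum absolute row sum. -/
def rowSupNorm {n m : Type*} [Fintype n] [Fintype m] (M : Matrix n m ℝ) : ℝ :=
  ⨆ i, ∑ j, |M i j|

/-- The sup norm of a vector. -/
def supNorm {m : Type*} [Fintype m] (x : m → ℝ) : ℝ :=
  ⨆ j, |x j|

/-- The sum of the absolute values of the coefficients of a polynomial. -/
def coeffNorm {m : ℕ} (p : MvPolynomial (Fin m) ℝ) : ℝ :=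
  ∑ mon ∈ p.support, |MvPolynomial.coeff mon p|

theorem supNorm_eq_norm {ι : Type*} [Fintype ι] (x : ι → ℝ) : supNorm x = ‖x‖ := by
  unfold supNorm
  apply le_antisymm
  · exact Real.iSup_le (fun j => norm_le_pi_norm x j) (norm_nonneg x)
  · refine (pi_norm_le_iff_of_nonneg (Real.iSup_nonneg fun j => abs_nonneg _)).2 fun j => ?_
    exact le_ciSup (f := fun j => |x j|) (Set.finite_range _).bddAbove j

theorem sum_abs_le_rowSupNorm {ι κ : Type*} [Fintype ι] [Fintype κ] (M : Matrix ι κ ℝ) (i : ι) :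
    ∑ j, |M i j| ≤ rowSupNorm M :=
  le_ciSup (f := fun i => ∑ j, |M i j|) (Set.finite_range _).bddAbove i

theorem rowSupNorm_nonneg {ι κ : Type*} [Fintype ι] [Fintype κ] (M : Matrix ι κ ℝ) :
    0 ≤ rowSupNorm M :=
  Real.iSup_nonneg fun _ => Finset.sum_nonneg fun _ _ => abs_nonneg _

/-- The continuous linear map of a real matrix. -/
def matrixCLM {ι κ : Type*} [Fintype ι] [Fintype κ] (M : Matrix ι κ ℝ) : (κ → ℝ) →L[ℝ] (ι → ℝ) :=
  LinearMap.toContinuousLinearMap M.mulVecLin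

@[simp]
theorem matrixCLM_apply {ι κ : Type*} [Fintype ι] [Fintype κ] (M : Matrix ι κ ℝ) (v : κ → ℝ) :
    matrixCLM M v = M *ᵥ v := rfl

theorem norm_matrixCLM_le {ι κ : Type*} [Fintype ι] [Fintype κ] (M : Matrix ι κ ℝ) {C : ℝ}
    (hC : 0 ≤ C) (h : ∀ i, ∑ j, |M i j| ≤ C) : ‖matrixCLM M‖ ≤ C := by
  refine ContinuousLinearMap.opNorm_le_bound _ hC fun v => ?_
  refine (pi_norm_le_iff_of_nonneg (by positivity)).2 fun i => ?_
  rw [matrixCLM_apply, Matrix.mulVec, dotProduct]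
  calc ‖∑ j, M i j * v j‖ ≤ ∑ j, ‖M i j * v j‖ := norm_sum_le _ _
    _ ≤ ∑ j, |M i j| * ‖v‖ := by
        refine Finset.sum_le_sum fun j _ => ?_
        rw [norm_mul, Real.norm_eq_abs (M i j)]
        gcongr
        exact norm_le_pi_norm v j
    _ = (∑ j, |M i j|) * ‖v‖ := by rw [Finset.sum_mul]
    _ ≤ C * ‖v‖ := by gcongr; exact h i

theorem norm_matrixCLM_le_rowSupNorm {ι κ : Type*} [Fintype ι] [Fintype κ] (M : Matrix ι κ ℝ) :
    ‖matrixCLM M‖ ≤ rowSupNorm M :=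
  norm_matrixCLM_le M (rowSupNorm_nonneg M) (sum_abs_le_rowSupNorm M)

/-- A simplified Newton iteration with a fixed approximate right inverse `T` of the derivative
converges to a zero. -/
theorem exists_zero_of_approx_right_inverse {E F : Type*} [NormedAddCommGroup E] [NormedSpace ℝ E]
    [NormedAddCommGroup F] [NormedSpace ℝ F] [CompleteSpace F] {f : E → F} {f' : E → E →L[ℝ] F}
    {x₀ : E} {ε κ : ℝ} (hε : 0 < ε) (hf : ∀ x, HasFDerivAt f (f' x) x) (T : F →L[ℝ] E)
    (hκ : 0 ≤ κ)
    (hbound : ∀ x, ‖x - x₀‖ ≤ ε → ‖(f' x).comp T - ContinuousLinearMap.id ℝ F‖ ≤ κ)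
    (h : κ < 1 - ε⁻¹ * ‖T‖ * ‖f x₀‖) : ∃ x, f x = 0 ∧ ‖x - x₀‖ < ε := by
  have hκ1 : κ < 1 := h.trans_le (by have : 0 ≤ ε⁻¹ * ‖T‖ * ‖f x₀‖ := by positivity
                                     linarith)
  have hκ1' : 0 < 1 - κ := by linarith
  set r : ℝ := ‖f x₀‖ / (1 - κ) with hr
  have hr0 : 0 ≤ r := by positivity
  have hrκ : κ * r + ‖f x₀‖ = r := by
    have : r * (1 - κ) = ‖f x₀‖ := by rw [hr]; field_simp
    linarith
  have hTr : ‖T‖ * r < ε := by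
    rw [hr, ← mul_div_assoc, div_lt_iff₀ hκ1']
    have h1 : ε⁻¹ * (‖T‖ * ‖f x₀‖) < 1 - κ := by linarith
    rwa [inv_mul_lt_iff₀ hε] at h1
  have hball : ∀ y ∈ Metric.closedBall (0 : F) r, ‖x₀ + T y - x₀‖ < ε := fun y hy => by
    rw [mem_closedBall_zero_iff] at hy
    rw [add_sub_cancel_left]
    exact (T.le_opNorm_of_le hy).trans_lt hTr
  let G : F → F := fun y => y - f (x₀ + T y)
  have hG : ∀ y, HasFDerivAt G (ContinuousLinearMap.id ℝ F - (f' (x₀ + T y)).comp T) y := fun y =>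
    (hasFDerivAt_id y).sub ((hf (x₀ + T y)).comp y (T.hasFDerivAt.const_add x₀))
  have hLip : ∀ y ∈ Metric.closedBall (0 : F) r, ∀ z ∈ Metric.closedBall (0 : F) r,
      ‖G z - G y‖ ≤ κ * ‖z - y‖ := fun y hy z hz =>
    (convex_closedBall (0 : F) r).norm_image_sub_le_of_norm_hasFDerivWithin_le
      (fun w _ => (hG w).hasFDerivWithinAt)
      (fun w hw => by rw [norm_sub_rev]; exact hbound _ (hball w hw).le) hy hz
  have h0 : (0 : F) ∈ Metric.closedBall (0 : F) r := Metric.mem_closedBall_self hr0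
  have hmaps : Set.MapsTo G (Metric.closedBall 0 r) (Metric.closedBall 0 r) := fun y hy => by
    have h1 := hLip 0 h0 y hy
    rw [mem_closedBall_zero_iff] at hy ⊢
    have h2 : ‖G 0‖ = ‖f x₀‖ := by simp [G]
    calc ‖G y‖ = ‖(G y - G 0) + G 0‖ := by rw [sub_add_cancel]
      _ ≤ ‖G y - G 0‖ + ‖G 0‖ := norm_add_le _ _
      _ ≤ κ * r + ‖f x₀‖ := by
          rw [h2, sub_zero] at *
          gcongr
          exact h1.trans (by gcongr)
      _ = r := hrκ
  have hcontr : ContractingWith ⟨κ, hκ⟩ (hmaps.restrict G _ _) :=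
    ⟨hκ1, LipschitzWith.of_dist_le_mul fun y z => by
      rw [Subtype.dist_eq, Subtype.dist_eq, dist_eq_norm, dist_eq_norm]
      exact hLip z z.2 y y.2⟩
  obtain ⟨y, hy, hfix, -⟩ := ContractingWith.exists_fixedPoint' Metric.isClosed_closedBall.isComplete
    hmaps hcontr h0 (edist_ne_top _ _)
  refine ⟨x₀ + T y, ?_, hball y hy⟩
  have : y - f (x₀ + T y) = y := hfix
  simpa using this

/-- The zero set of an analytic map is a smooth manifold near a point where the derivative is
surjective. -/
theorem exists_chart_zero_set_of_surjective {m n : ℕ} {f : (Fin m → ℝ) → (Fin n → ℝ)}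
    {x : Fin m → ℝ} (hf : ContDiff ℝ ⊤ f) {A : (Fin m → ℝ) →L[ℝ] (Fin n → ℝ)}
    (hA : HasFDerivAt f A x) (hsurj : Function.Surjective A) :
    ∃ (U : Set (Fin m → ℝ)) (V : Set (Fin (m - n) → ℝ))
      (g : (Fin m → ℝ) → (Fin (m - n) → ℝ)) (h : (Fin (m - n) → ℝ) → (Fin m → ℝ)),
      IsOpen U ∧ x ∈ U ∧ IsOpen V ∧
      ContDiffOn ℝ (⊤ : ℕ∞) g U ∧ ContDiffOn ℝ (⊤ : ℕ∞) h V ∧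
      (∀ z ∈ U ∩ {y | f y = 0}, g z ∈ V ∧ h (g z) = z) ∧
      (∀ w ∈ V, h w ∈ U ∩ {y | f y = 0} ∧ g (h w) = w) := by
  let K := LinearMap.ker (A : (Fin m → ℝ) →ₗ[ℝ] (Fin n → ℝ))
  have hrank : n + Module.finrank ℝ K = m := by
    have h1 := LinearMap.finrank_range_add_finrank_ker (A : (Fin m → ℝ) →ₗ[ℝ] (Fin n → ℝ))
    rw [LinearMap.range_eq_top.2 hsurj, finrank_top] at h1
    simpa using h1
  have hK : Module.finrank ℝ K = Module.finrank ℝ (Fin (m - n) → ℝ) := by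
    simp; omega
  let e : K ≃ₗ[ℝ] (Fin (m - n) → ℝ) := LinearEquiv.ofFinrankEq _ _ hK
  obtain ⟨P, hP⟩ := K.subtype.exists_leftInverse_of_injective K.ker_subtype
  let Q : (Fin m → ℝ) →L[ℝ] (Fin (m - n) → ℝ) :=
    LinearMap.toContinuousLinearMap (e.toLinearMap ∘ₗ P)
  have hinj : Function.Injective (A.prod Q).toLinearMap := by
    rw [← LinearMap.ker_eq_bot, LinearMap.ker_eq_bot']
    intro v hv
    have h1 : A v = 0 := congrArg Prod.fst hv
    have h2 : e (P v) = 0 := congrArg Prod.snd hv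
    have h3 : P v = ⟨v, h1⟩ := LinearMap.congr_fun hP ⟨v, h1⟩
    rw [h3, map_eq_zero_iff e e.injective] at h2
    exact congrArg Subtype.val h2
  let Φ' : (Fin m → ℝ) ≃L[ℝ] (Fin n → ℝ) × (Fin (m - n) → ℝ) :=
    (LinearMap.linearEquivOfInjective (A.prod Q).toLinearMap hinj
      (by simp; omega)).toContinuousLinearEquiv
  let Φ : (Fin m → ℝ) → (Fin n → ℝ) × (Fin (m - n) → ℝ) := fun z => (f z, Q z)
  have hΦ : ContDiff ℝ ⊤ Φ := hf.prodMk Q.contDiff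
  have hΦ' : HasFDerivAt Φ (Φ' : (Fin m → ℝ) →L[ℝ] (Fin n → ℝ) × (Fin (m - n) → ℝ)) x :=
    hA.prodMk Q.hasFDerivAt
  let E := hΦ.contDiffAt.toOpenPartialHomeomorph Φ hΦ' (by simp)
  have hEx : x ∈ E.source := hΦ.contDiffAt.mem_toOpenPartialHomeomorph_source hΦ' (by simp)
  have hsymm : ContDiffAt ℝ ⊤ E.symm (Φ x) := hΦ.contDiffAt.to_localInverse hΦ' (by simp)
  obtain ⟨W, hW, hWo, hxW⟩ := eventually_nhds_iff.1 ((hsymm.eventually (by simp)).and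
    (E.open_target.mem_nhds (E.map_source hEx)))
  have hι : Continuous fun w : Fin (m - n) → ℝ => ((0 : Fin n → ℝ), w) := by fun_prop
  refine ⟨E.source ∩ Φ ⁻¹' W, {w | ((0 : Fin n → ℝ), w) ∈ W}, Q, fun w => E.symm (0, w),
    E.open_source.inter (hWo.preimage hΦ.continuous), ⟨hEx, hxW⟩, hWo.preimage hι,
    Q.contDiff.contDiffOn, ?_, ?_, ?_⟩
  · intro w hw
    have h1 : ContDiffAt ℝ (⊤ : ℕ∞) E.symm ((0 : Fin n → ℝ), w) := (hW _ hw).1.of_le le_top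
    exact (h1.comp w (contDiffAt_const.prodMk contDiffAt_id)).contDiffWithinAt
  · rintro z ⟨⟨hz, hzW⟩, hz0⟩
    have h1 : Φ z = (0, Q z) := Prod.ext hz0 rfl
    refine ⟨?_, ?_⟩
    · simpa [h1] using hzW
    · change E.symm (0, Q z) = z
      rw [← h1]
      exact E.left_inv hz
  · intro w hw
    have h1 : Φ (E.symm (0, w)) = (0, w) := E.right_inv (hW _ hw).2
    refine ⟨⟨⟨E.map_target (hW _ hw).2, ?_⟩, congrArg Prod.fst h1⟩, congrArg Prod.snd h1⟩
    rw [Set.mem_preimage, h1]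
    exact hw

namespace MvPolynomial

variable {σ : Type*}

theorem abs_eval_monomial_le [Fintype σ] {x : σ → ℝ} {M : ℝ} (hx : ‖x‖ ≤ M) (b : σ →₀ ℕ) :
    |eval x (monomial b (1 : ℝ))| ≤ M ^ b.degree := by
  rw [eval_monomial, one_mul, Finsupp.prod, Finset.abs_prod, Finsupp.degree_apply,
    ← Finset.prod_pow_eq_pow_sum]
  refine Finset.prod_le_prod (fun _ _ => abs_nonneg _) fun i _ => ?_
  rw [abs_pow]
  exact pow_le_pow_left₀ (abs_nonneg _) ((norm_le_pi_norm x i).trans hx) _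

theorem abs_eval_monomial_sub_le [Fintype σ] {x y : σ → ℝ} {M : ℝ} (hx : ‖x‖ ≤ M) (hy : ‖y‖ ≤ M)
    (b : σ →₀ ℕ) :
    |eval x (monomial b (1 : ℝ)) - eval y (monomial b (1 : ℝ))| ≤
      b.degree * M ^ (b.degree - 1) * ‖x - y‖ := by
  have hM : 0 ≤ M := (norm_nonneg x).trans hx
  induction b using Finsupp.induction_linear with
  | zero => simp
  | add a b ha hb =>
    have hmul : (monomial (a + b) (1 : ℝ)) = monomial a 1 * monomial b 1 := by
      simp [monomial_mul]
    have hpow : ∀ k l : ℕ, (l : ℝ) * (M ^ k * M ^ (l - 1)) = l * M ^ (k + l - 1) := by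
      intro k l
      cases l with
      | zero => simp
      | succ l => simp [← pow_add, ← add_assoc]
    have hax := abs_eval_monomial_le hx a
    have hby := abs_eval_monomial_le hy b
    rw [hmul, map_mul, map_mul, map_add]
    set X := eval x (monomial a (1 : ℝ))
    set Y := eval y (monomial a (1 : ℝ))
    set X' := eval x (monomial b (1 : ℝ))
    set Y' := eval y (monomial b (1 : ℝ))
    calc |X * X' - Y * Y'| = |X * (X' - Y') + (X - Y) * Y'| := by congr 1; ring
      _ ≤ |X| * |X' - Y'| + |X - Y| * |Y'| := by
          rw [← abs_mul, ← abs_mul]; exact abs_add_le _ _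
      _ ≤ M ^ a.degree * (b.degree * M ^ (b.degree - 1) * ‖x - y‖) +
          (a.degree * M ^ (a.degree - 1) * ‖x - y‖) * M ^ b.degree := by gcongr
      _ = (b.degree * (M ^ a.degree * M ^ (b.degree - 1)) +
          a.degree * (M ^ b.degree * M ^ (a.degree - 1))) * ‖x - y‖ := by ring
      _ = _ := by
          rw [hpow, hpow, add_comm b.degree]
          push_cast
          ring
  | single i k =>
    have hi : |x i - y i| ≤ ‖x - y‖ := norm_le_pi_norm (x - y) i
    simp only [eval_monomial, Finsupp.degree_single, one_mul, Finsupp.prod_single_index, pow_zero]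
    refine (abs_pow_sub_pow_le _ _ _).trans ?_
    rw [mul_assoc, mul_comm]
    gcongr
    exact max_le ((norm_le_pi_norm x i).trans hx) ((norm_le_pi_norm y i).trans hy)

/-- A Lipschitz constant, on the sup-norm ball of radius `M`, of the `j`-th partial derivative. -/
def pderivLipConst (p : MvPolynomial σ ℝ) (M : ℝ) (j : σ) : ℝ :=
  ∑ a ∈ p.support, |coeff a p| * (a j * ((a.degree - 1 : ℕ) * M ^ (a.degree - 2)))

theorem abs_eval_pderiv_sub_le [Fintype σ] (p : MvPolynomial σ ℝ) {x y : σ → ℝ} {M : ℝ} (hx : ‖x‖ ≤ M)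
    (hy : ‖y‖ ≤ M) (j : σ) :
    |eval x (pderiv j p) - eval y (pderiv j p)| ≤ pderivLipConst p M j * ‖x - y‖ := by
  have hM : 0 ≤ M := (norm_nonneg x).trans hx
  have hexp : ∀ z : σ → ℝ, eval z (pderiv j p) = ∑ a ∈ p.support,
      coeff a p * (a j * eval z (monomial (a - Finsupp.single j 1) (1 : ℝ))) := by
    intro z
    conv_lhs => rw [p.as_sum]
    rw [map_sum, map_sum]
    refine Finset.sum_congr rfl fun a _ => ?_
    rw [pderiv_monomial, eval_monomial, eval_monomial]
    ring
  rw [hexp, hexp, ← Finset.sum_sub_distrib, pderivLipConst, Finset.sum_mul]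
  refine (Finset.abs_sum_le_sum_abs _ _).trans (Finset.sum_le_sum fun a _ => ?_)
  rw [← mul_sub, ← mul_sub, abs_mul, abs_mul, Nat.abs_cast, mul_assoc, mul_assoc]
  gcongr ?_ * ?_
  rcases Nat.eq_zero_or_pos (a j) with h0 | hpos
  · simp [h0]
  have hdeg : (a - Finsupp.single j 1).degree = a.degree - 1 := by
    have h1 : a - Finsupp.single j 1 + Finsupp.single j 1 = a :=
      tsub_add_cancel_of_le (Finsupp.single_le_iff.2 hpos)
    have h2 := congrArg Finsupp.degree h1
    rw [map_add, Finsupp.degree_single] at h2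
    omega
  have h3 := abs_eval_monomial_sub_le hx hy (a - Finsupp.single j 1)
  rw [hdeg, Nat.sub_sub] at h3
  gcongr

theorem pderivLipConst_nonneg (p : MvPolynomial σ ℝ) {M : ℝ} (hM : 0 ≤ M) (j : σ) :
    0 ≤ pderivLipConst p M j :=
  Finset.sum_nonneg fun _ _ => by positivity

theorem hasFDerivAt_eval [Fintype σ] (p : MvPolynomial σ ℝ) (x : σ → ℝ) :
    HasFDerivAt (fun y : σ → ℝ => eval y p)
      (∑ j, eval x (pderiv j p) • ContinuousLinearMap.proj (R := ℝ) (φ := fun _ : σ => ℝ) j) x := by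
  classical
  induction p using MvPolynomial.induction_on with
  | C a => simpa using hasFDerivAt_const a x
  | add p q hp hq =>
    simp only [map_add, add_smul, Finset.sum_add_distrib]
    exact hp.add hq
  | mul_X p i hp =>
    have h := hp.mul (hasFDerivAt_apply (𝕜 := ℝ) i x)
    simp only [map_mul, eval_X]
    refine h.congr_fderiv ?_
    simp only [Derivation.leibniz, pderiv_X, smul_eq_mul, map_add, map_mul, eval_X, add_smul,
      Finset.sum_add_distrib, Finset.smul_sum, smul_smul]
    congr 1
    simp [Pi.single_apply, Finset.sum_ite_eq, apply_ite]

theorem abs_secant_sub_pderiv_le [Fintype σ] [DecidableEq σ] (p : MvPolynomial σ ℝ) {x : σ → ℝ} {M δ : ℝ}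
    (hδ : 0 < δ) (hM : ‖x‖ + δ ≤ M) (j : σ) :
    |(eval (x + δ • (Pi.single j 1 : σ → ℝ)) p - eval x p) / δ - eval x (pderiv j p)| ≤
      1 / 2 * δ * pderivLipConst p M j := by
  let γ : ℝ → σ → ℝ := fun s => x + s • (Pi.single j 1 : σ → ℝ)
  have hγ : ∀ s, HasDerivAt γ (Pi.single j 1 : σ → ℝ) s := fun s => by
    refine (((hasDerivAt_id s).smul_const (Pi.single j 1 : σ → ℝ)).const_add x).congr_deriv ?_
    rw [one_smul]
  let φ : ℝ → ℝ := fun s => eval (γ s) p - eval x p - s * eval x (pderiv j p)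
  have hφ : ∀ s, HasDerivAt φ (eval (γ s) (pderiv j p) - eval x (pderiv j p)) s := fun s => by
    have h1 := (hasFDerivAt_eval p (γ s)).comp_hasDerivAt s (hγ s)
    have h2 := (h1.sub_const (eval x p)).sub
      ((hasDerivAt_id s).mul_const (eval x (pderiv j p)))
    refine h2.congr_deriv ?_
    simp [Pi.single_apply]
  have hγnorm : ∀ s, 0 ≤ s → ‖γ s - x‖ ≤ s := fun s hs => by
    simp only [γ, add_sub_cancel_left, norm_smul, Pi.norm_single, norm_one, mul_one,
      Real.norm_eq_abs, abs_of_nonneg hs, le_refl]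
  have hx : ‖x‖ ≤ M := by linarith
  have hL := pderivLipConst_nonneg p ((norm_nonneg x).trans hx) j
  have key := image_norm_le_of_norm_deriv_right_le_deriv_boundary (f := φ)
    (f' := fun s => eval (γ s) (pderiv j p) - eval x (pderiv j p)) (a := 0) (b := δ)
    (B := fun s => pderivLipConst p M j * s ^ 2 / 2) (B' := fun s => pderivLipConst p M j * s)
    (fun s _ => (hφ s).continuousAt.continuousWithinAt)
    (fun s _ => (hφ s).hasDerivWithinAt) (by simp [φ, γ])
    (fun s => by
      have h1 := ((hasDerivAt_pow 2 s).const_mul (pderivLipConst p M j)).div_const 2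
      refine h1.congr_deriv ?_
      simp; ring)
    (fun s hs => by
      have h1 := hγnorm s hs.1
      have h2 : ‖γ s‖ ≤ M := by
        have := norm_le_norm_add_norm_sub' (γ s) x
        linarith [hs.2]
      exact (abs_eval_pderiv_sub_le p h2 hx j).trans (by gcongr))
    (Set.right_mem_Icc.2 hδ.le)
  have hdiv : (eval (x + δ • (Pi.single j 1 : σ → ℝ)) p - eval x p) / δ - eval x (pderiv j p) =
      φ δ / δ := by
    simp only [φ, γ]
    field_simp
  rw [hdiv, abs_div, abs_of_pos hδ, div_le_iff₀ hδ]
  refine (show |φ δ| ≤ _ from key).trans (le_of_eq ?_)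
  ring

theorem contDiff_eval [Fintype σ] (p : MvPolynomial σ ℝ) : ContDiff ℝ ⊤ fun x : σ → ℝ => eval x p :=
  (AnalyticOnNhd.eval_mvPolynomial p).contDiff

end MvPolynomial

theorem natCast_mul_sub_one_nonneg (d : ℕ) : 0 ≤ (d : ℝ) * ((d : ℝ) - 1) := by
  rcases Nat.eq_zero_or_pos d with h | h
  · simp [h]
  · exact mul_nonneg (by positivity) (sub_nonneg.2 (by exact_mod_cast h))

theorem sum_pderivLipConst_le {m d : ℕ} (p : MvPolynomial (Fin m) ℝ) (hd : p.totalDegree ≤ d)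
    {M : ℝ} (hM : 1 ≤ M) :
    ∑ j, p.pderivLipConst M j ≤ coeffNorm p * (d * ((d : ℝ) - 1) * M ^ (d - 2)) := by
  simp only [MvPolynomial.pderivLipConst, coeffNorm]
  rw [Finset.sum_comm, Finset.sum_mul]
  refine Finset.sum_le_sum fun a ha => ?_
  rw [← Finset.mul_sum, ← Finset.sum_mul]
  refine mul_le_mul_of_nonneg_left ?_ (abs_nonneg _)
  have hdeg : a.degree ≤ d := by
    refine le_trans ?_ hd
    rw [Finsupp.degree_apply]
    exact MvPolynomial.le_totalDegree ha
  have hsum : ∑ j, (a j : ℝ) = a.degree := by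
    rw [Finsupp.degree_eq_sum]
    push_cast
    rfl
  rw [hsum]
  rcases Nat.eq_zero_or_pos a.degree with h0 | hpos
  · rw [h0, Nat.cast_zero, zero_mul]
    exact mul_nonneg (natCast_mul_sub_one_nonneg d) (by positivity)
  · have h1 : ((d - 1 : ℕ) : ℝ) = (d : ℝ) - 1 := by
      rw [Nat.cast_sub (hpos.trans_le hdeg), Nat.cast_one]
    rw [← h1, mul_assoc]
    gcongr

/-- The Jacobian matrix of a polynomial map. -/
def jacobian {m n : ℕ} (p : Fin n → MvPolynomial (Fin m) ℝ) (x : Fin m → ℝ) :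
    Matrix (Fin n) (Fin m) ℝ :=
  Matrix.of fun i j => MvPolynomial.eval x (MvPolynomial.pderiv j (p i))

theorem hasFDerivAt_jacobian {m n : ℕ} (p : Fin n → MvPolynomial (Fin m) ℝ) (x : Fin m → ℝ) :
    HasFDerivAt (fun y i => MvPolynomial.eval y (p i)) (matrixCLM (jacobian p x)) x := by
  rw [hasFDerivAt_pi']
  intro i
  refine (MvPolynomial.hasFDerivAt_eval (p i) x).congr_fderiv ?_
  ext v
  simp [jacobian, Matrix.mulVec, dotProduct]

theorem sum_abs_jacobian_sub_secant_le {m n d : ℕ} (p : Fin n → MvPolynomial (Fin m) ℝ)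
    (hd : ∀ i, (p i).totalDegree ≤ d) {x₀ x : Fin m → ℝ} {δ ε : ℝ} (hδ : 0 < δ) (hε : 0 < ε)
    (hx : ‖x - x₀‖ ≤ ε) (i : Fin n) :
    ∑ j, |jacobian p x i j - (MvPolynomial.eval (x₀ + δ • (Pi.single j 1 : Fin m → ℝ)) (p i)
        - MvPolynomial.eval x₀ (p i)) / δ| ≤
      ((1 / 2) * (δ * max 1 (‖x₀‖ + δ) ^ (d - 2)) + ε * max 1 (‖x₀‖ + ε) ^ (d - 2)) *
        coeffNorm (p i) * d * ((d : ℝ) - 1) := by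
  set Mδ := max 1 (‖x₀‖ + δ)
  set Mε := max 1 (‖x₀‖ + ε)
  have hxM : ‖x‖ ≤ Mε := by
    have := norm_le_norm_add_norm_sub' x x₀
    exact le_trans (by linarith) (le_max_right _ _)
  have hx₀M : ‖x₀‖ ≤ Mε := le_trans (by linarith) (le_max_right _ _)
  have hMε : 0 ≤ Mε := (norm_nonneg _).trans hxM
  calc _ ≤ ∑ j, ((p i).pderivLipConst Mε j * ε + 1 / 2 * δ * (p i).pderivLipConst Mδ j) := by
        refine Finset.sum_le_sum fun j _ => ?_
        refine (abs_sub_le _ (MvPolynomial.eval x₀ (MvPolynomial.pderiv j (p i))) _).trans ?_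
        refine add_le_add ?_ ?_
        · refine (MvPolynomial.abs_eval_pderiv_sub_le (p i) hxM hx₀M j).trans ?_
          have := MvPolynomial.pderivLipConst_nonneg (p i) hMε j
          gcongr
        · rw [abs_sub_comm]
          exact MvPolynomial.abs_secant_sub_pderiv_le (p i) hδ (le_max_right _ _) j
    _ = (∑ j, (p i).pderivLipConst Mε j) * ε + 1 / 2 * δ * ∑ j, (p i).pderivLipConst Mδ j := by
        rw [Finset.sum_add_distrib, Finset.sum_mul, Finset.mul_sum]
    _ ≤ coeffNorm (p i) * (d * ((d : ℝ) - 1) * Mε ^ (d - 2)) * ε +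
        1 / 2 * δ * (coeffNorm (p i) * (d * ((d : ℝ) - 1) * Mδ ^ (d - 2))) := by
        gcongr
        · exact sum_pderivLipConst_le (p i) (hd i) (le_max_left _ _)
        · exact sum_pderivLipConst_le (p i) (hd i) (le_max_left _ _)
    _ = _ := by ring

/-- A continuous linear endomorphism at distance less than one from the identity is surjective. -/
theorem surjective_of_norm_sub_id_lt_one {F : Type*} [NormedAddCommGroup F] [NormedSpace ℝ F]
    [CompleteSpace F] (B : F →L[ℝ] F) (hB : ‖B - ContinuousLinearMap.id ℝ F‖ < 1) :
    Function.Surjective B := by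
  have h1 : ‖ContinuousLinearMap.id ℝ F - B‖ < 1 := by rwa [norm_sub_rev]
  obtain ⟨u, hu⟩ : IsUnit B := by
    have := isUnit_one_sub_of_norm_lt_one (R := F →L[ℝ] F) h1
    rwa [show (1 : F →L[ℝ] F) - (ContinuousLinearMap.id ℝ F - B) = B from sub_sub_cancel _ _]
      at this
  intro y
  refine ⟨(↑u⁻¹ : F →L[ℝ] F) y, ?_⟩
  rw [← hu]
  exact DFunLike.congr_fun u.mul_inv y

theorem newton_kantorovich_secant (m n dg : ℕ)
    (p : Fin n → MvPolynomial (Fin m) ℝ)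
    (hdg : ∀ i, (p i).totalDegree ≤ dg)
    (x₀ : Fin m → ℝ) (δ ε : ℝ) (hδ : 0 < δ) (hε : 0 < ε)
    (S : Matrix (Fin n) (Fin m) ℝ)
    (hS : S = fun i j =>
      (MvPolynomial.eval (x₀ + δ • (Pi.single j 1 : Fin m → ℝ)) (p i)
        - MvPolynomial.eval x₀ (p i)) / δ)
    (T : Matrix (Fin m) (Fin n) ℝ)
    (hineq : rowSupNorm (S * T - 1)
        + ((1 / 2) * (δ * max 1 (supNorm x₀ + δ) ^ (dg - 2))
            + ε * max 1 (supNorm x₀ + ε) ^ (dg - 2))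
          * (⨆ i, coeffNorm (p i)) * dg * ((dg : ℝ) - 1) * rowSupNorm T
      < 1 - ε⁻¹ * rowSupNorm T * supNorm (fun i => MvPolynomial.eval x₀ (p i))) :
    ∃ xs : Fin m → ℝ,
      (∀ i, MvPolynomial.eval xs (p i) = 0) ∧
      supNorm (xs - x₀) < ε ∧
      -- the zero set of f is locally a smooth manifold of dimension m - n near xs:
      ∃ (U : Set (Fin m → ℝ)) (V : Set (Fin (m - n) → ℝ))
        (g : (Fin m → ℝ) → (Fin (m - n) → ℝ)) (h : (Fin (m - n) → ℝ) → (Fin m → ℝ)),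
        IsOpen U ∧ xs ∈ U ∧ IsOpen V ∧
        ContDiffOn ℝ (⊤ : ℕ∞) g U ∧ ContDiffOn ℝ (⊤ : ℕ∞) h V ∧
        (∀ z ∈ U ∩ {x | ∀ i, MvPolynomial.eval x (p i) = 0}, g z ∈ V ∧ h (g z) = z) ∧
        (∀ w ∈ V, h w ∈ U ∩ {x | ∀ i, MvPolynomial.eval x (p i) = 0} ∧ g (h w) = w) := by
  set f : (Fin m → ℝ) → (Fin n → ℝ) := fun y i => MvPolynomial.eval y (p i)
  set c : ℝ := ⨆ i, coeffNorm (p i)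
  have hci : ∀ i, coeffNorm (p i) ≤ c := fun i =>
    le_ciSup (f := fun i => coeffNorm (p i)) (Set.finite_range _).bddAbove i
  have hc0 : 0 ≤ c := Real.iSup_nonneg fun i => Finset.sum_nonneg fun _ _ => abs_nonneg _
  have hd0 := natCast_mul_sub_one_nonneg dg
  simp only [supNorm_eq_norm] at hineq ⊢
  set a : ℝ := (1 / 2) * (δ * max 1 (‖x₀‖ + δ) ^ (dg - 2)) + ε * max 1 (‖x₀‖ + ε) ^ (dg - 2)
  have ha0 : 0 ≤ a := by positivity
  have hC0 : 0 ≤ a * c * dg * ((dg : ℝ) - 1) := by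
    rw [mul_assoc]
    exact mul_nonneg (mul_nonneg ha0 hc0) hd0
  set κ : ℝ := rowSupNorm (S * T - 1) + a * c * dg * ((dg : ℝ) - 1) * rowSupNorm T
  have hκ0 : 0 ≤ κ := add_nonneg (rowSupNorm_nonneg _) (mul_nonneg hC0 (rowSupNorm_nonneg _))
  have hjac : ∀ x, ‖x - x₀‖ ≤ ε →
      ‖matrixCLM (jacobian p x - S)‖ ≤ a * c * dg * ((dg : ℝ) - 1) := fun x hx => by
    refine norm_matrixCLM_le _ hC0 fun i => ?_
    rw [hS]
    refine (sum_abs_jacobian_sub_secant_le p hdg hδ hε hx i).trans ?_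
    rw [mul_assoc, mul_assoc _ (dg : ℝ)]
    exact mul_le_mul_of_nonneg_right (mul_le_mul_of_nonneg_left (hci i) ha0) hd0
  have hbound : ∀ x, ‖x - x₀‖ ≤ ε → ‖(matrixCLM (jacobian p x)).comp (matrixCLM T) -
      ContinuousLinearMap.id ℝ (Fin n → ℝ)‖ ≤ κ := fun x hx => by
    have hsplit : (matrixCLM (jacobian p x)).comp (matrixCLM T) -
        ContinuousLinearMap.id ℝ (Fin n → ℝ) =
        matrixCLM (S * T - 1) + (matrixCLM (jacobian p x - S)).comp (matrixCLM T) := by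
      refine ContinuousLinearMap.ext fun v => ?_
      simp [Matrix.sub_mulVec, Matrix.sub_mul]
    rw [hsplit]
    refine (norm_add_le _ _).trans (add_le_add (norm_matrixCLM_le_rowSupNorm _) ?_)
    refine (ContinuousLinearMap.opNorm_comp_le _ _).trans ?_
    exact mul_le_mul (hjac x hx) (norm_matrixCLM_le_rowSupNorm T) (norm_nonneg _) hC0
  have hlt : κ < 1 - ε⁻¹ * ‖matrixCLM T‖ * ‖f x₀‖ := by
    refine hineq.trans_le (sub_le_sub_left ?_ 1)
    gcongr
    exact norm_matrixCLM_le_rowSupNorm T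
  obtain ⟨xs, hxs, hdist⟩ := exists_zero_of_approx_right_inverse hε (hasFDerivAt_jacobian p)
    (matrixCLM T) hκ0 hbound hlt
  have hκ1 : κ < 1 := hlt.trans_le (sub_le_self 1 (by positivity))
  have hsurj : Function.Surjective (matrixCLM (jacobian p xs)) :=
    Function.Surjective.of_comp
      (surjective_of_norm_sub_id_lt_one _ ((hbound xs hdist.le).trans_lt hκ1))
  refine ⟨xs, congrFun hxs, hdist, ?_⟩
  have hchart := exists_chart_zero_set_of_surjective
    (contDiff_pi.2 fun i => MvPolynomial.contDiff_eval (p i)) (hasFDerivAt_jacobian p xs) hsurj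
  simpa only [funext_iff, Pi.zero_apply] using hchart
end
end

section
/- Fix a polynomial map f: ℝ^m → ℝ^n of total degree d, a point x₀ ∈ ℝ^m, and δ > 0, and let S: ℝ^m → ℝ^n be the δ-secant approximation of the Jacobian of f at x₀, defined on the standard basis by S e_j = (f(x₀ + δe_j) − f(x₀))/δ. Then ‖S − Df(x₀)‖_{∞→∞} ≤ (1/2)·δ·max{1, ‖x₀‖_∞ + δ}^{d−2}·|f|·d(d−1), where Df(x₀) denotes the Jacobian of f at x₀. -/
noncomputable section

open Matrix

/-- The second-order Taylor remainder of `t ↦ t ^ k`. -/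
lemma abs_add_pow_sub_sub_le {x δ M : ℝ} (hx : |x| ≤ M) (hxδ : |x + δ| ≤ M) (k : ℕ) :
    |(x + δ) ^ k - x ^ k - δ * (k * x ^ (k - 1))|
      ≤ δ ^ 2 / 2 * M ^ (k - 2) * (k * ((k : ℝ) - 1)) := by
  have hM : 0 ≤ M := (abs_nonneg _).trans hx
  rcases k with _ | _ | k
  · simp
  · simp
  induction k with
  | zero =>
    refine le_of_eq ?_
    rw [show (x + δ) ^ (0 + 1 + 1) - x ^ (0 + 1 + 1)
      - δ * (((0 + 1 + 1 : ℕ) : ℝ) * x ^ (0 + 1 + 1 - 1)) = δ ^ 2 by norm_num; ring,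
      abs_of_nonneg (sq_nonneg δ)]
    norm_num
  | succ k ih =>
    simp only [Nat.add_sub_cancel, Nat.reduceSubDiff] at ih ⊢
    have hsplit : (x + δ) ^ (k + 1 + 1 + 1) - x ^ (k + 1 + 1 + 1)
        - δ * (((k + 1 + 1 + 1 : ℕ) : ℝ) * x ^ (k + 1 + 1))
        = (x + δ) * ((x + δ) ^ (k + 1 + 1) - x ^ (k + 1 + 1)
          - δ * (((k + 1 + 1 : ℕ) : ℝ) * x ^ (k + 1)))
          + (k + 2) * δ ^ 2 * x ^ (k + 1) := by
      push_cast; ring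
    rw [hsplit]
    refine (abs_add_le _ _).trans ?_
    have hfirst := mul_le_mul hxδ ih (abs_nonneg _) hM
    have hsecond : (k + 2) * δ ^ 2 * |x| ^ (k + 1) ≤ (k + 2) * δ ^ 2 * M ^ (k + 1) := by gcongr
    rw [abs_mul, abs_mul, abs_pow, abs_of_nonneg (by positivity : (0 : ℝ) ≤ (k + 2) * δ ^ 2)]
    refine (add_le_add hfirst hsecond).trans (le_of_eq ?_)
    push_cast; ring

namespace MvPolynomial

variable {σ : Type*} [Fintype σ] [DecidableEq σ]

/-- The value of a monomial, with the `j`-th variable singled out. -/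
lemma eval_monomial_eq_mul_prod_erase (x : σ → ℝ) (s : σ →₀ ℕ) (c : ℝ) (j : σ) :
    eval x (monomial s c) = c * (x j ^ s j * ∏ i ∈ Finset.univ.erase j, x i ^ s i) := by
  rw [eval_monomial, Finsupp.prod_fintype _ _ (fun i => pow_zero _),
    Finset.mul_prod_erase _ (fun i => x i ^ s i) (Finset.mem_univ j)]

/-- The error of the first-order expansion of a monomial in one coordinate direction. -/
lemma abs_eval_monomial_sub_sub_le {x : σ → ℝ} {δ M : ℝ} (hM : 1 ≤ M) (hx : ∀ i, |x i| + |δ| ≤ M)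
    {d : ℕ} {s : σ →₀ ℕ} (hs : ∑ i, s i ≤ d) (c : ℝ) (j : σ) :
    |eval (x + δ • (Pi.single j 1 : σ → ℝ)) (monomial s c) - eval x (monomial s c)
        - δ * eval x (pderiv j (monomial s c))|
      ≤ |c| * (δ ^ 2 / 2 * M ^ (d - 2) * (s j * ((s j : ℝ) - 1))) := by
  have hx' : ∀ i, |x i| ≤ M := fun i => (le_add_of_nonneg_right (abs_nonneg δ)).trans (hx i)
  have hpos : 0 ≤ M := zero_le_one.trans hM
  set P := ∏ i ∈ Finset.univ.erase j, x i ^ s i with hP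
  have hshift : ∏ i ∈ Finset.univ.erase j, (x + δ • (Pi.single j 1 : σ → ℝ)) i ^ s i = P :=
    Finset.prod_congr rfl fun i hi => by simp [Finset.ne_of_mem_erase hi]
  have hderiv : ∏ i ∈ Finset.univ.erase j, x i ^ (s - Finsupp.single j 1 : σ →₀ ℕ) i = P :=
    Finset.prod_congr rfl fun i hi => by
      simp [(Finset.ne_of_mem_erase hi).symm]
  have hPle : |P| ≤ M ^ ∑ i ∈ Finset.univ.erase j, s i := by
    rw [hP, Finset.abs_prod, ← Finset.prod_pow_eq_pow_sum]
    refine Finset.prod_le_prod (fun _ _ => abs_nonneg _) fun i _ => ?_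
    rw [abs_pow]
    exact pow_le_pow_left₀ (abs_nonneg _) (hx' i) _
  have hsum : s j + ∑ i ∈ Finset.univ.erase j, s i = ∑ i, s i :=
    Finset.add_sum_erase _ _ (Finset.mem_univ j)
  have hfactor : eval (x + δ • (Pi.single j 1 : σ → ℝ)) (monomial s c) - eval x (monomial s c)
        - δ * eval x (pderiv j (monomial s c))
      = c * (((x j + δ) ^ s j - x j ^ s j - δ * (s j * x j ^ (s j - 1))) * P) := by
    rw [pderiv_monomial, eval_monomial_eq_mul_prod_erase _ _ _ j,
      eval_monomial_eq_mul_prod_erase _ _ _ j, eval_monomial_eq_mul_prod_erase _ _ _ j,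
      hshift, hderiv]
    simp
    ring
  rw [hfactor, abs_mul, abs_mul]
  refine mul_le_mul_of_nonneg_left ?_ (abs_nonneg c)
  have hpow := abs_add_pow_sub_sub_le (hx' j) ((abs_add_le _ _).trans (hx j)) (s j)
  refine (mul_le_mul hpow hPle (abs_nonneg _) ((abs_nonneg _).trans hpow)).trans ?_
  rcases le_or_gt 2 (s j) with h | h
  · have hexp : M ^ (s j - 2) * M ^ ∑ i ∈ Finset.univ.erase j, s i ≤ M ^ (d - 2) := by
      rw [← pow_add]
      exact pow_le_pow_right₀ hM (by omega)
    have hcoef : (0 : ℝ) ≤ δ ^ 2 / 2 * (s j * ((s j : ℝ) - 1)) := by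
      have : (2 : ℝ) ≤ s j := by exact_mod_cast h
      have : (0 : ℝ) ≤ (s j : ℝ) - 1 := by linarith
      positivity
    calc _ = δ ^ 2 / 2 * (s j * ((s j : ℝ) - 1))
          * (M ^ (s j - 2) * M ^ ∑ i ∈ Finset.univ.erase j, s i) := by ring
      _ ≤ δ ^ 2 / 2 * (s j * ((s j : ℝ) - 1)) * M ^ (d - 2) := by gcongr
      _ = _ := by ring
  · have hzero : (s j : ℝ) * ((s j : ℝ) - 1) = 0 := by
      interval_cases s j <;> simp
    simp [hzero]

end MvPolynomial

lemma sum_mul_sub_one_le {σ : Type*} [Fintype σ] {d : ℕ} {s : σ →₀ ℕ} (hs : ∑ i, s i ≤ d) :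
    ∑ j, (s j : ℝ) * ((s j : ℝ) - 1) ≤ d * ((d : ℝ) - 1) := by
  have hle : ∀ j, s j ≤ d := fun j =>
    (Finset.single_le_sum (fun _ _ => Nat.zero_le _) (Finset.mem_univ j)).trans hs
  rcases Nat.eq_zero_or_pos d with rfl | hd
  · have hzero : ∀ j, s j = 0 := fun j => Nat.le_zero.mp (hle j)
    simp [hzero]
  have hd' : (0 : ℝ) ≤ (d : ℝ) - 1 := by
    have : (1 : ℝ) ≤ d := by exact_mod_cast hd
    linarith
  calc ∑ j, (s j : ℝ) * ((s j : ℝ) - 1) ≤ ∑ j, (s j : ℝ) * ((d : ℝ) - 1) := by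
        gcongr with j
        exact_mod_cast hle j
    _ = ((∑ j, s j : ℕ) : ℝ) * ((d : ℝ) - 1) := by rw [← Finset.sum_mul]; push_cast; rfl
    _ ≤ d * ((d : ℝ) - 1) := by gcongr

/-- The absolute row sum of the errors of the first-order expansion of a polynomial in the
coordinate directions. -/
lemma sum_abs_eval_sub_sub_le {m : ℕ} {x : Fin m → ℝ} {δ M : ℝ} (hM : 1 ≤ M)
    (hx : ∀ i, |x i| + |δ| ≤ M) {d : ℕ} {p : MvPolynomial (Fin m) ℝ} (hp : p.totalDegree ≤ d) :
    ∑ j, |MvPolynomial.eval (x + δ • (Pi.single j 1 : Fin m → ℝ)) p - MvPolynomial.eval x p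
        - δ * MvPolynomial.eval x (MvPolynomial.pderiv j p)|
      ≤ δ ^ 2 / 2 * M ^ (d - 2) * coeffNorm p * (d * ((d : ℝ) - 1)) := by
  have hpos : 0 ≤ M := zero_le_one.trans hM
  have hdeg : ∀ s ∈ p.support, ∑ i, s i ≤ d := fun s hs => by
    refine le_trans (le_of_eq ?_) ((MvPolynomial.le_totalDegree hs).trans hp)
    rw [Finsupp.sum_fintype _ _ (fun _ => rfl)]
  have hterm : ∀ j, |MvPolynomial.eval (x + δ • (Pi.single j 1 : Fin m → ℝ)) p
        - MvPolynomial.eval x p - δ * MvPolynomial.eval x (MvPolynomial.pderiv j p)|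
      ≤ ∑ s ∈ p.support, |p.coeff s| * (δ ^ 2 / 2 * M ^ (d - 2) * (s j * ((s j : ℝ) - 1))) := by
    intro j
    have hexpand : MvPolynomial.eval (x + δ • (Pi.single j 1 : Fin m → ℝ)) p
        - MvPolynomial.eval x p - δ * MvPolynomial.eval x (MvPolynomial.pderiv j p)
        = ∑ s ∈ p.support,
          (MvPolynomial.eval (x + δ • (Pi.single j 1 : Fin m → ℝ))
              (MvPolynomial.monomial s (p.coeff s))
            - MvPolynomial.eval x (MvPolynomial.monomial s (p.coeff s))
            - δ * MvPolynomial.eval x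
              (MvPolynomial.pderiv j (MvPolynomial.monomial s (p.coeff s)))) := by
      rw [Finset.sum_sub_distrib, Finset.sum_sub_distrib, ← Finset.mul_sum, ← map_sum, ← map_sum,
        ← map_sum, ← map_sum, ← MvPolynomial.as_sum]
    rw [hexpand]
    exact (Finset.abs_sum_le_sum_abs _ _).trans (Finset.sum_le_sum fun s hs =>
      MvPolynomial.abs_eval_monomial_sub_sub_le hM hx (hdeg s hs) _ j)
  refine (Finset.sum_le_sum fun j _ => hterm j).trans ?_
  rw [Finset.sum_comm, coeffNorm, Finset.mul_sum, Finset.sum_mul]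
  refine Finset.sum_le_sum fun s hs => ?_
  rw [← Finset.mul_sum, ← Finset.mul_sum]
  calc _ ≤ |p.coeff s| * (δ ^ 2 / 2 * M ^ (d - 2) * (d * ((d : ℝ) - 1))) := by
        gcongr
        exact sum_mul_sub_one_le (hdeg s hs)
    _ = _ := by ring

theorem secant_jacobian_error_bound (m n dg : ℕ)
    (p : Fin n → MvPolynomial (Fin m) ℝ)
    (hdg : ∀ i, (p i).totalDegree ≤ dg)
    (x₀ : Fin m → ℝ) (δ : ℝ) (hδ : 0 < δ)
    (S : Matrix (Fin n) (Fin m) ℝ)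
    (hS : S = fun i j =>
      (MvPolynomial.eval (x₀ + δ • (Pi.single j 1 : Fin m → ℝ)) (p i) - MvPolynomial.eval x₀ (p i)) / δ)
    (Df : Matrix (Fin n) (Fin m) ℝ)
    (hDf : Df = fun i j => MvPolynomial.eval x₀ (MvPolynomial.pderiv j (p i))) :
    rowSupNorm (S - Df)
      ≤ (1 / 2) * δ * max 1 (supNorm x₀ + δ) ^ (dg - 2)
        * (⨆ i, coeffNorm (p i)) * dg * ((dg : ℝ) - 1) := by
  have hx : ∀ i, |x₀ i| + |δ| ≤ max 1 (supNorm x₀ + δ) := fun i => by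
    rw [abs_of_pos hδ]
    refine le_max_of_le_right (add_le_add_left ?_ δ)
    exact le_ciSup (f := fun j => |x₀ j|) (Set.finite_range _).bddAbove i
  have hdd : (0 : ℝ) ≤ dg * ((dg : ℝ) - 1) := by
    rcases Nat.eq_zero_or_pos dg with rfl | h
    · simp
    · have : (1 : ℝ) ≤ dg := by exact_mod_cast h
      exact mul_nonneg (by positivity) (by linarith)
  have hcoeff : ∀ i, 0 ≤ coeffNorm (p i) := fun i => Finset.sum_nonneg fun _ _ => abs_nonneg _
  rw [mul_assoc _ (dg : ℝ)]
  refine Real.iSup_le (fun i => ?_) (mul_nonneg (mul_nonneg (by positivity)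
    (Real.iSup_nonneg hcoeff)) hdd)
  have hrow : ∑ j, |(S - Df) i j| = (∑ j,
      |MvPolynomial.eval (x₀ + δ • (Pi.single j 1 : Fin m → ℝ)) (p i) - MvPolynomial.eval x₀ (p i)
        - δ * MvPolynomial.eval x₀ (MvPolynomial.pderiv j (p i))|) / δ := by
    rw [Finset.sum_div]
    refine Finset.sum_congr rfl fun j _ => ?_
    rw [← abs_of_pos hδ, ← abs_div, abs_of_pos hδ, Matrix.sub_apply, hS, hDf]
    congr 1
    field_simp
  rw [hrow, div_le_iff₀ hδ]
  refine (sum_abs_eval_sub_sub_le (le_max_left _ _) hx (hdg i)).trans ?_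
  calc _ ≤ δ ^ 2 / 2 * max 1 (supNorm x₀ + δ) ^ (dg - 2) * (⨆ i, coeffNorm (p i))
        * (dg * ((dg : ℝ) - 1)) := by
        gcongr
        exact le_ciSup (f := fun i => coeffNorm (p i)) (Set.finite_range _).bddAbove i
    _ = _ := by ring
end
end

section
/- Let q be an odd prime power. Any two (q+1)×(q+1) matrices of the form C_{i,j} = χ([t_i, t_j]) — where [·,·] is a symplectic form on a 2-dimensional 𝔽_q-vector space V, t_1, …, t_{q+1} ∈ V are nonzero vectors spanning distinct one-dimensional subspaces, and χ is the quadratic character of 𝔽_q — are switching equivalent: one can be obtained from the other by negating some rows and the corresponding columns and applying a simultaneous permutation of rows and columns. -/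
noncomputable section

open Matrix

/-- A nonzero alternating nondegenerate form on a plane admits a symplectic basis. -/
theorem exists_symplectic_basis {F V : Type*} [Field F] [AddCommGroup V] [Module F V]
    (hV : Module.finrank F V = 2) (ω : V →ₗ[F] V →ₗ[F] F)
    (halt : ∀ v, ω v v = 0) (hnd : ∀ v, v ≠ 0 → ∃ u, ω v u ≠ 0) :
    ∃ b : Module.Basis (Fin 2) F V, ω (b 0) (b 1) = 1 ∧ ω (b 1) (b 0) = -1 := by
  have : Nontrivial V := Module.nontrivial_of_finrank_pos (R := F) (by omega)
  obtain ⟨e, he⟩ := exists_ne (0 : V)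
  obtain ⟨u, hu⟩ := hnd e he
  set f : V := (ω e u)⁻¹ • u with hf
  have hef : ω e f = 1 := by simp [hf, hu]
  have hfe : ω f e = -1 := by
    have h := halt (e + f)
    simp only [map_add, LinearMap.add_apply, halt, hef] at h
    linear_combination h
  have hli : LinearIndependent F ![e, f] := by
    rw [LinearIndependent.pair_iff]
    intro a b h
    have h1 := congrArg (ω e) h
    have h2 := congrArg (ω f) h
    simp only [map_add, map_smul, halt, hef, hfe, map_zero, smul_eq_mul] at h1 h2
    exact ⟨by linear_combination -h2, by linear_combination h1⟩
  refine ⟨basisOfLinearIndependentOfCardEqFinrank hli (by simp [hV]), ?_, ?_⟩ <;> simpa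

/-- Two symplectic planes over the same field are isometric. -/
theorem exists_symplectic_isometry {F V W : Type*} [Field F]
    [AddCommGroup V] [Module F V] [AddCommGroup W] [Module F W]
    (hV : Module.finrank F V = 2) (hW : Module.finrank F W = 2)
    (ω : V →ₗ[F] V →ₗ[F] F) (ω' : W →ₗ[F] W →ₗ[F] F)
    (halt : ∀ v, ω v v = 0) (hnd : ∀ v, v ≠ 0 → ∃ u, ω v u ≠ 0)
    (halt' : ∀ w, ω' w w = 0) (hnd' : ∀ w, w ≠ 0 → ∃ u, ω' w u ≠ 0) :
    ∃ L : W ≃ₗ[F] V, ∀ w w', ω (L w) (L w') = ω' w w' := by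
  obtain ⟨b, hb, hb'⟩ := exists_symplectic_basis hV ω halt hnd
  obtain ⟨c, hc, hc'⟩ := exists_symplectic_basis hW ω' halt' hnd'
  refine ⟨c.equiv b (Equiv.refl _), fun w w' => ?_⟩
  have h : ω.compl₁₂ (c.equiv b (Equiv.refl _)).toLinearMap (c.equiv b (Equiv.refl _)).toLinearMap
      = ω' := by
    refine c.ext fun i => c.ext fun j => ?_
    fin_cases i <;> fin_cases j <;> simp [hb, hb', hc, hc', halt, halt']
  exact congrArg (fun B => B w w') h

/-- Over a field with `q` elements, `q + 1` nonzero vectors of a plane that span distinct lines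
span all lines. -/
theorem exists_eq_smul_of_span_injective {F V : Type*} [Field F] [Fintype F]
    [AddCommGroup V] [Module F V] (hV : Module.finrank F V = 2)
    {t : Fin (Fintype.card F + 1) → V} (ht0 : ∀ i, t i ≠ 0)
    (htdist : Function.Injective fun i => Submodule.span F {t i}) {v : V} (hv : v ≠ 0) :
    ∃ i, ∃ a : F, a ≠ 0 ∧ v = a • t i := by
  have hcard : Nat.card (Projectivization F V) = Fintype.card F + 1 := by
    rw [Projectivization.card_of_finrank_two F V hV, Nat.card_eq_fintype_card]
  have : Finite (Projectivization F V) := Nat.finite_of_card_ne_zero (by omega)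
  let p : Fin (Fintype.card F + 1) → Projectivization F V := fun i => .mk F (t i) (ht0 i)
  have hp : Function.Injective p := fun i j h => htdist <| by
    simpa [p, Projectivization.submodule_mk] using congrArg Projectivization.submodule h
  obtain ⟨i, hi⟩ := (hp.bijective_of_nat_card_le (by simp [hcard])).2 (.mk F v hv)
  obtain ⟨a, ha⟩ := (Projectivization.mk_eq_mk_iff F v (t i) hv (ht0 i)).1 hi.symm
  exact ⟨i, a, a.ne_zero, ha.symm⟩

theorem symplectic_conference_matrices_switching_equivalent
    (q : ℕ) (hq : IsPrimePow q) (hodd : Odd q)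
    (F : Type*) [Field F] [Fintype F] [DecidableEq F] (hcard : Fintype.card F = q)
    (V W : Type*) [AddCommGroup V] [Module F V] [AddCommGroup W] [Module F W]
    (hV : Module.finrank F V = 2) (hW : Module.finrank F W = 2)
    (ω : V →ₗ[F] V →ₗ[F] F) (ω' : W →ₗ[F] W →ₗ[F] F)
    (hωalt : ∀ v, ω v v = 0) (hωnd : ∀ v, v ≠ 0 → ∃ u, ω v u ≠ 0)
    (hω'alt : ∀ w, ω' w w = 0) (hω'nd : ∀ w, w ≠ 0 → ∃ u, ω' w u ≠ 0)
    (t : Fin (q + 1) → V) (s : Fin (q + 1) → W)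
    (ht0 : ∀ i, t i ≠ 0) (hs0 : ∀ i, s i ≠ 0)
    (htdist : Function.Injective fun i => Submodule.span F {t i})
    (hsdist : Function.Injective fun i => Submodule.span F {s i})
    (C C' : Matrix (Fin (q + 1)) (Fin (q + 1)) ℤ)
    (hC : C = fun i j => quadraticChar F (ω (t i) (t j)))
    (hC' : C' = fun i j => quadraticChar F (ω' (s i) (s j))) :
    ∃ (σ : Equiv.Perm (Fin (q + 1))) (η : Fin (q + 1) → ℤ),
      (∀ i, η i = 1 ∨ η i = -1) ∧
      ∀ i j, C' i j = η i * η j * C (σ i) (σ j) := by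
  subst hcard hC hC'
  obtain ⟨L, hL⟩ := exists_symplectic_isometry hV hW ω ω' hωalt hωnd hω'alt hω'nd
  choose σ a ha hσ using fun i =>
    exists_eq_smul_of_span_injective hV ht0 htdist (L.map_ne_zero_iff.2 (hs0 i))
  have hσinj : Function.Injective σ := fun i j hij => hsdist <| by
    have hspan (k) : Submodule.map L.toLinearMap (Submodule.span F {s k}) =
        Submodule.span F {t (σ k)} := by
      rw [Submodule.map_span, Set.image_singleton, LinearEquiv.coe_coe, hσ,
        Submodule.span_singleton_smul_eq (ha k).isUnit]
    apply Submodule.map_injective_of_injective (f := L.toLinearMap) L.injective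
    simp only [hspan, hij]
  refine ⟨.ofBijective σ (Finite.injective_iff_bijective.1 hσinj), fun i => quadraticChar F (a i),
    fun i => quadraticChar_dichotomy (ha i), fun i j => ?_⟩
  simp only [Equiv.ofBijective_apply, ← hL, hσ, map_smul, LinearMap.smul_apply, smul_eq_mul,
    map_mul]
  ring
end
end

section
/- Let q be an odd prime power, let K be a finite field with q² elements, let F = {z ∈ K : z^q = z} be its subfield with q elements, and let ζ be a generator of the multiplicative group K^×. Define [x, y] = ζ^{(q+1)/2}(x y^q − y x^q) for x, y ∈ K. Then: (i) [x, y] ∈ F for all x, y ∈ K; (ii) [·,·] is F-bilinear (viewing K as a 2-dimensional F-vector space) and alternating; (iii) [·,·] is nondegenerate, i.e., for every nonzero x ∈ K there exists y ∈ K with [x, y] ≠ 0; and (iv) [zx, zy] = z^{q+1}[x, y] for all x, y, z ∈ K. -/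
noncomputable section

theorem sub_pow_of_card_eq_sq {K : Type*} [Field K] [Fintype K] {q : ℕ}
    (hq : IsPrimePow q) (hcard : Fintype.card K = q ^ 2) (x y : K) :
    (x - y) ^ q = x ^ q - y ^ q := by
  obtain ⟨p, n, hp, -, rfl⟩ := hq
  have : Fact p.Prime := ⟨hp.nat_prime⟩
  have : CharP K p := charP_of_card_eq_prime_pow (hcard.trans (pow_mul p n 2).symm)
  exact sub_pow_char_pow x y n

/-- The half-order power of a generator of the unit group of a finite field of odd
cardinality is `-1`. -/
theorem generator_pow_half_eq_neg_one {K : Type*} [Field K] [Fintype K] {m : ℕ}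
    (hm : 0 < m) (hcard : Fintype.card K = 2 * m + 1)
    (ζ : Kˣ) (hζ : ∀ u : Kˣ, u ∈ Subgroup.zpowers ζ) : (ζ : K) ^ m = -1 := by
  have hord : orderOf ζ = 2 * m := by
    rw [orderOf_eq_card_of_forall_mem_zpowers hζ, Nat.card_units, Nat.card_eq_fintype_card,
      hcard, Nat.add_sub_cancel]
  have hsq : ((ζ : K) ^ m) ^ 2 = 1 := by
    rw [← pow_mul, mul_comm m, ← hord, ← Units.val_pow_eq_pow_val, pow_orderOf_eq_one,
      Units.val_one]
  refine (mul_self_eq_one_iff.mp (by rw [← sq, hsq])).resolve_left fun h => ?_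
  have hone : ζ ^ m = 1 := Units.ext (by simpa using h)
  have := Nat.le_of_dvd hm (hord ▸ orderOf_dvd_of_pow_eq_one hone)
  omega

theorem symplectic_form_on_quadratic_extension
    (q : ℕ) (hq : IsPrimePow q) (hodd : Odd q)
    (K : Type*) [Field K] [Fintype K] (hcard : Fintype.card K = q ^ 2)
    (ζ : Kˣ) (hζ : ∀ u : Kˣ, u ∈ Subgroup.zpowers ζ)
    (B : K → K → K)
    (hB : B = fun x y => (ζ : K) ^ ((q + 1) / 2) * (x * y ^ q - y * x ^ q)) :
    -- (i) values lie in the subfield F = {z : K | z ^ q = z}: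
    (∀ x y, (B x y) ^ q = B x y) ∧
    -- (ii) F-bilinear and alternating:
    (∀ x x' y, B (x + x') y = B x y + B x' y) ∧
    (∀ x y y', B x (y + y') = B x y + B x y') ∧
    (∀ c x y, c ^ q = c → B (c * x) y = c * B x y ∧ B x (c * y) = c * B x y) ∧
    (∀ x, B x x = 0) ∧
    -- (iii) nondegenerate:
    (∀ x, x ≠ 0 → ∃ y, B x y ≠ 0) ∧
    -- (iv) scaling identity:
    (∀ z x y, B (z * x) (z * y) = z ^ (q + 1) * B x y) := by
  have hfrob : ∀ x : K, (x ^ q) ^ q = x := fun x => by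
    rw [← pow_mul, ← sq, ← hcard, FiniteField.pow_card]
  have hsub := sub_pow_of_card_eq_sq hq hcard
  have hadd : ∀ x y : K, (x + y) ^ q = x ^ q + y ^ q := fun x y => by
    have h := hsub (x + y) y
    rw [add_sub_cancel_right] at h
    rw [h, sub_add_cancel]
  set ε : K := (ζ : K) ^ ((q + 1) / 2) with hε_def
  have hε0 : ε ≠ 0 := pow_ne_zero _ ζ.ne_zero
  obtain ⟨k, rfl⟩ := hodd
  have hk : 0 < k := Nat.pos_of_ne_zero fun h => hq.one_lt.ne' (by simp [h])
  have hhalf : (ζ : K) ^ (2 * k * (k + 1)) = -1 :=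
    generator_pow_half_eq_neg_one (by positivity) (by rw [hcard]; ring) ζ hζ
  have hε : ε ^ (2 * k + 1) = -ε := by
    rw [hε_def, show (2 * k + 1 + 1) / 2 = k + 1 by omega, ← pow_mul,
      show (k + 1) * (2 * k + 1) = 2 * k * (k + 1) + (k + 1) by ring, pow_add, hhalf, neg_one_mul]
  have hneg : -ε ≠ ε := fun h => by
    have hchar : ringChar K ≠ 2 := fun h2 => by
      have := FiniteField.even_card_of_char_two h2
      rw [hcard] at this
      have : (2 * k + 1) ^ 2 = 2 * (2 * k * (k + 1)) + 1 := by ring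
      omega
    exact hε0 ((Ring.eq_self_iff_eq_zero_of_char_ne_two hchar).mp h)
  generalize 2 * k + 1 = q at *
  subst hB
  refine ⟨fun x y => ?_, fun x x' y => ?_, fun x y y' => ?_, fun c x y hc => ⟨?_, ?_⟩,
    fun x => ?_, fun x hx => ⟨ε * x, ?_⟩, fun z x y => ?_⟩
  · simp only [mul_pow, hsub, hfrob, hε]
    ring
  · simp only [hadd]
    ring
  · simp only [hadd]
    ring
  · simp only [mul_pow, hc]
    ring
  · simp only [mul_pow, hc]
    ring
  · ring
  · have h : ε * (x * (ε * x) ^ q - ε * x * x ^ q) = ε * ((-ε - ε) * (x * x ^ q)) := by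
      rw [mul_pow, hε]
      ring
    simp only [h]
    exact mul_ne_zero hε0 (mul_ne_zero (sub_ne_zero.mpr hneg) (mul_ne_zero hx (pow_ne_zero _ hx)))
  · simp only [mul_pow, pow_succ]
    ring
end
end
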